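/- Worst-case rounding modes bound all solutions of a rounded-addition constraint: let x, z ∈ 𝔽, and say that y ∈ 𝔽 is a solution under mode r ∈ {↓, n, ↑} if [y + z]r = x (equality of extended reals). (i) If the set of solutions under ↑ is nonempty and ŷ is its minimum, then every y ∈ 𝔽 that is a solution under ↓, under n, or under ↑ satisfies ŷ ≤ y. (ii) Dually, if the set of solutions under ↓ is nonempty and ỹ is its maximum, then every y ∈ 𝔽 that is a solution under ↓, under n, or under ↑ satisfies y ≤ ỹ. -/

import Mathlib

noncomputable section

open scoped Classical

namespace FPVerif

/-- The set of finite IEEE 754 binary floating-point numbers with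
precision `p` and maximum exponent `emax` (minimum exponent `1 - emax`),
viewed as a set of real numbers. -/
def F (p emax : ℤ) : Set ℝ :=
  {x | ∃ (s : ℝ) (e M : ℤ), (s = 1 ∨ s = -1) ∧
    1 - emax ≤ e ∧ e ≤ emax ∧ (0 : ℝ) ≤ (M : ℝ) ∧ (M : ℝ) ≤ (2 : ℝ) ^ p - 1 ∧
    x = s * (M : ℝ) * (2 : ℝ) ^ (e + 1 - p)}

/-- The smallest positive float. -/
def fmin (p emax : ℤ) : ℝ := (2 : ℝ) ^ ((1 - emax) + 1 - p)

/-- The largest float. -/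
def fmax (p emax : ℤ) : ℝ := (2 : ℝ) ^ emax * (2 - (2 : ℝ) ^ (1 - p))

/-- The successor of `x` in `F p emax` (meaningful when `x ∈ F` and `x < fmax`). -/
def fsucc (p emax : ℤ) (x : ℝ) : ℝ := sInf {y | y ∈ F p emax ∧ x < y}

/-- The predecessor of `x` in `F p emax` (meaningful when `x ∈ F` and `-fmax < x`). -/
def fpred (p emax : ℤ) (x : ℝ) : ℝ := sSup {y | y ∈ F p emax ∧ y < x}

/-- Round toward minus infinity, valued in the extended reals. -/
def rndDown (p emax : ℤ) (x : ℝ) : EReal :=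
  if x < -fmax p emax then ⊥
  else ((sSup {z | z ∈ F p emax ∧ z ≤ x} : ℝ) : EReal)

/-- Round toward plus infinity, valued in the extended reals. -/
def rndUp (p emax : ℤ) (x : ℝ) : EReal :=
  if fmax p emax < x then ⊤
  else ((sInf {z | z ∈ F p emax ∧ x ≤ z} : ℝ) : EReal)

/-- Round toward zero, valued in the extended reals. -/
def rndZero (p emax : ℤ) (x : ℝ) : EReal :=
  if 0 < x then rndDown p emax x else rndUp p emax x

/-- A float `z` is even if it is zero or its mantissa digit string ends in 0,
i.e. `z / 2 ^ (e_z + 1 - p)` is an even integer, where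
`e_z = max (1 - emax) ⌊log₂ |z|⌋`. -/
def FEven (p emax : ℤ) (z : ℝ) : Prop :=
  z = 0 ∨ ∃ k : ℤ, Even k ∧
    z = (k : ℝ) * (2 : ℝ) ^ (max (1 - emax) (Int.log 2 |z|) + 1 - p)

/-- The set of floats at minimal distance from `x`. -/
def nearestSet (p emax : ℤ) (x : ℝ) : Set ℝ :=
  {z | z ∈ F p emax ∧ ∀ w ∈ F p emax, |x - z| ≤ |x - w|}

/-- The float at minimal distance from `x`, a tie being broken by
choosing the even one. -/
def nearest (p emax : ℤ) (x : ℝ) : ℝ :=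
  if h : ∃ z, z ∈ nearestSet p emax x ∧ FEven p emax z then h.choose
  else if h2 : ∃ z, z ∈ nearestSet p emax x then h2.choose
  else 0

/-- Round to nearest (ties to even), valued in the extended reals. -/
def rndNear (p emax : ℤ) (x : ℝ) : EReal :=
  if (2 : ℝ) ^ emax * (2 - (2 : ℝ) ^ (-p)) ≤ x then ⊤
  else if x ≤ -((2 : ℝ) ^ emax * (2 - (2 : ℝ) ^ (-p))) then ⊥
  else ((nearest p emax x : ℝ) : EReal)

/-- Twice the downward round-to-nearest error bound `∇2n−`. -/
def nablaNm (p emax : ℤ) (x : ℝ) : ℝ :=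
  if x = -fmax p emax then x - fsucc p emax x else fpred p emax x - x

/-- Twice the upward round-to-nearest error bound `∇2n+`. -/
def nablaNp (p emax : ℤ) (x : ℝ) : ℝ :=
  if x = fmax p emax then x - fpred p emax x else fsucc p emax x - x

end FPVerif

open FPVerif

lemma fmax_eq (p emax : ℤ) :
    fmax p emax = ((2 : ℝ) ^ p - 1) * (2 : ℝ) ^ (emax + 1 - p) := by
  have h2 : (2 : ℝ) ≠ 0 := by norm_num
  have h3 : (2 : ℝ) ^ p ≠ 0 := zpow_ne_zero _ h2
  unfold fmax
  rw [zpow_sub₀ h2, zpow_sub₀ h2, zpow_add₀ h2]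
  simp only [zpow_one]
  field_simp

lemma fmax_mem (p emax : ℤ) (hp : 2 ≤ p) (he : 1 ≤ emax) : fmax p emax ∈ F p emax := by
  have hpow : (2 : ℝ) ^ p = (2 : ℝ) ^ p.toNat := by
    rw [← zpow_natCast, Int.toNat_of_nonneg (by omega)]
  have h1 : (1 : ℝ) ≤ (2 : ℝ) ^ p.toNat := one_le_pow₀ (by norm_num)
  refine ⟨1, emax, 2 ^ p.toNat - 1, Or.inl rfl, by omega, le_refl _, ?_, ?_, ?_⟩
  · push_cast; linarith
  · push_cast; rw [hpow]
  · rw [fmax_eq, hpow]; push_cast; ring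

lemma neg_mem_F {p emax : ℤ} {x : ℝ} (h : x ∈ F p emax) : -x ∈ F p emax := by
  obtain ⟨s, e, M, hs, h1, h2, h3, h4, rfl⟩ := h
  refine ⟨-s, e, M, ?_, h1, h2, h3, h4, by ring⟩
  rcases hs with rfl | rfl <;> simp

lemma le_fmax {p emax : ℤ} {x : ℝ} (h : x ∈ F p emax) : x ≤ fmax p emax := by
  obtain ⟨s, e, M, hs, h1, h2, h3, h4, rfl⟩ := h
  have ha : (2 : ℝ) ^ (e + 1 - p) ≤ (2 : ℝ) ^ (emax + 1 - p) :=
    zpow_le_zpow_right₀ (by norm_num) (by omega)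
  have hb : (0 : ℝ) < (2 : ℝ) ^ (e + 1 - p) := by positivity
  have hc : (M : ℝ) * (2 : ℝ) ^ (e + 1 - p) ≤ fmax p emax := by
    rw [fmax_eq]
    exact mul_le_mul h4 ha hb.le (by linarith)
  have hd : 0 ≤ (M : ℝ) * (2 : ℝ) ^ (e + 1 - p) := mul_nonneg h3 hb.le
  rcases hs with rfl | rfl <;> linarith

lemma neg_fmax_le {p emax : ℤ} {x : ℝ} (h : x ∈ F p emax) : -fmax p emax ≤ x := by
  have := le_fmax (neg_mem_F h)
  linarith

lemma F_finite (p emax : ℤ) : (F p emax).Finite := by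
  have hfin : (({1, -1} : Set ℝ) ×ˢ (Set.Icc (1 - emax) emax ×ˢ
      Set.Icc (0 : ℤ) ⌊(2 : ℝ) ^ p⌋)).Finite :=
    (Set.toFinite _).prod ((Set.finite_Icc _ _).prod (Set.finite_Icc _ _))
  refine (hfin.image
    (fun t : ℝ × ℤ × ℤ => t.1 * (t.2.2 : ℝ) * (2 : ℝ) ^ (t.2.1 + 1 - p))).subset ?_
  rintro x ⟨s, e, M, hs, h1, h2, h3, h4, rfl⟩
  refine ⟨(s, e, M), ⟨?_, ⟨h1, h2⟩, ⟨by exact_mod_cast h3, ?_⟩⟩, rfl⟩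
  · simpa using hs
  · exact Int.le_floor.2 (by linarith)

lemma nearest_mem (p emax : ℤ) (hp : 2 ≤ p) (he : 1 ≤ emax) (x : ℝ) :
    nearest p emax x ∈ nearestSet p emax x := by
  have hne : ∃ z, z ∈ nearestSet p emax x := by
    obtain ⟨z, hz, h⟩ := Set.exists_min_image (F p emax) (fun w => |x - w|)
      (F_finite p emax) ⟨_, fmax_mem p emax hp he⟩
    exact ⟨z, hz, h⟩
  unfold nearest
  split_ifs with h
  · exact h.choose_spec.1
  · exact hne.choose_spec

lemma rndNear_spec {p emax : ℤ} (hp : 2 ≤ p) (he : 1 ≤ emax) {t x : ℝ}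
    (h : rndNear p emax t = (x : EReal)) : x ∈ nearestSet p emax t := by
  unfold rndNear at h
  split_ifs at h with h1 h2
  · exact absurd h (EReal.coe_ne_top x).symm
  · exact absurd h (EReal.coe_ne_bot x).symm
  · rw [← EReal.coe_eq_coe_iff.1 h]
    exact nearest_mem p emax hp he t

lemma rndUp_spec {p emax : ℤ} (hp : 2 ≤ p) (he : 1 ≤ emax) {t x : ℝ}
    (h : rndUp p emax t = (x : EReal)) : t ≤ x := by
  unfold rndUp at h
  split_ifs at h with h1
  · exact absurd h (EReal.coe_ne_top x).symm
  · rw [← EReal.coe_eq_coe_iff.1 h]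
    exact le_csInf ⟨_, fmax_mem p emax hp he, not_lt.1 h1⟩ fun _ hw => hw.2

lemma rndDown_spec {p emax : ℤ} (hp : 2 ≤ p) (he : 1 ≤ emax) {t x : ℝ}
    (h : rndDown p emax t = (x : EReal)) : x ≤ t := by
  unfold rndDown at h
  split_ifs at h with h1
  · exact absurd h (EReal.coe_ne_bot x).symm
  · rw [← EReal.coe_eq_coe_iff.1 h]
    exact csSup_le ⟨_, neg_mem_F (fmax_mem p emax hp he), not_lt.1 h1⟩ fun _ hw => hw.2

lemma rndUp_of_near {p emax : ℤ} {t x : ℝ} (htx : t ≤ x)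
    (h : x ∈ nearestSet p emax t) : rndUp p emax t = (x : EReal) := by
  have hl : IsLeast {z | z ∈ F p emax ∧ t ≤ z} x := by
    refine ⟨⟨h.1, htx⟩, fun w hw => ?_⟩
    have := h.2 w hw.1
    rw [abs_of_nonpos (by linarith), abs_of_nonpos (by linarith [hw.2])] at this
    linarith
  unfold rndUp
  rw [if_neg (not_lt.2 (htx.trans (le_fmax h.1))), hl.csInf_eq]

lemma rndDown_of_near {p emax : ℤ} {t x : ℝ} (htx : x ≤ t)
    (h : x ∈ nearestSet p emax t) : rndDown p emax t = (x : EReal) := by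
  have hl : IsGreatest {z | z ∈ F p emax ∧ z ≤ t} x := by
    refine ⟨⟨h.1, htx⟩, fun w hw => ?_⟩
    have := h.2 w hw.1
    rw [abs_of_nonneg (by linarith), abs_of_nonneg (by linarith [hw.2])] at this
    linarith
  unfold rndDown
  rw [if_neg (not_lt.2 ((neg_fmax_le h.1).trans htx)), hl.csSup_eq]

/-- Worst-case rounding modes bound all solutions of a rounded-addition
constraint `[y + z]r = x`:
(i) the minimum solution under `↑` is a lower bound for every solution under
any of the three modes; (ii) the maximum solution under `↓` is an upper bound
for every solution under any of the three modes. -/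
theorem worst_case_rounding_addition (p emax : ℤ) (hp : 2 ≤ p) (he : 1 ≤ emax)
    (x z : ℝ) (hx : x ∈ F p emax) (hz : z ∈ F p emax) :
    (∀ yhat : ℝ, yhat ∈ F p emax →
      rndUp p emax (yhat + z) = (x : EReal) →
      (∀ y' ∈ F p emax, rndUp p emax (y' + z) = (x : EReal) → yhat ≤ y') →
      ∀ y ∈ F p emax,
        (rndDown p emax (y + z) = (x : EReal) ∨
         rndNear p emax (y + z) = (x : EReal) ∨
         rndUp p emax (y + z) = (x : EReal)) →
        yhat ≤ y) ∧
    (∀ ytil : ℝ, ytil ∈ F p emax →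
      rndDown p emax (ytil + z) = (x : EReal) →
      (∀ y' ∈ F p emax, rndDown p emax (y' + z) = (x : EReal) → y' ≤ ytil) →
      ∀ y ∈ F p emax,
        (rndDown p emax (y + z) = (x : EReal) ∨
         rndNear p emax (y + z) = (x : EReal) ∨
         rndUp p emax (y + z) = (x : EReal)) →
        y ≤ ytil) := by
  constructor
  · intro yhat _ hup hmin y hy h
    by_contra! hlt
    have h1 := rndUp_spec hp he hup
    rcases h with h | h | h
    · have := rndDown_spec hp he h
      linarith
    · have := hmin y hy (rndUp_of_near (by linarith) (rndNear_spec hp he h))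
      linarith
    · have := hmin y hy h
      linarith
  · intro ytil _ hdn hmax y hy h
    by_contra! hlt
    have h1 := rndDown_spec hp he hdn
    rcases h with h | h | h
    · have := hmax y hy h
      linarith
    · have := hmax y hy (rndDown_of_near (by linarith) (rndNear_spec hp he h))
      linarith
    · have := rndUp_spec hp he h
      linarith
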